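/- arXiv:2209.07288 — 4 statements merged into one kernel-verified Lean document; each statement's English description precedes it below -/
import Mathlib

section
/- Let γ ∈ [0,1), η ∈ ℝ, q ∈ ℝ, x₀ ∈ ℝ, and β, b⁺, b⁻ ∈ ℝ, and set c = (1-β)·b⁺ + β·b⁻. For each shift constant b ∈ ℝ define the sequence (x^b_t) by x^b_0 = x₀ and x^b_{t+1} = x^b_t - 2η·(x^b_t - (q + b/(1-γ))), and define the error ε^b_t = x^b_t - b/(1-γ) - q. Then for every t ∈ ℕ, (1-β)·ε^{b⁺}_t + β·ε^{b⁻}_t = ε^{c}_t. -/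
theorem shifted_error_linear_combination
    (γ : ℝ) (hγ0 : 0 ≤ γ) (hγ1 : γ < 1)
    (η q x₀ β bp bm : ℝ)
    (c : ℝ) (hc : c = (1 - β) * bp + β * bm)
    (x : ℝ → ℕ → ℝ)
    (hx0 : ∀ b : ℝ, x b 0 = x₀)
    (hrec : ∀ (b : ℝ) (t : ℕ),
      x b (t + 1) = x b t - 2 * η * (x b t - (q + b / (1 - γ))))
    (ε : ℝ → ℕ → ℝ)
    (hε : ∀ (b : ℝ) (t : ℕ), ε b t = x b t - b / (1 - γ) - q) :
    ∀ t : ℕ, (1 - β) * ε bp t + β * ε bm t = ε c t := by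
  intro t
  induction t with
  | zero =>
    simp only [hε, hx0, hc]
    ring
  | succ t ih =>
    have hstep (b : ℝ) : ε b (t + 1) = (1 - 2 * η) * ε b t := by
      rw [hε, hε, hrec]
      ring
    rw [hstep, hstep, hstep, ← ih]
    ring
end

section
/- Let γ ∈ [0,1), η ∈ ℝ, q ∈ ℝ, x₀ ∈ ℝ, and β, b⁺, b⁻ ∈ ℝ, and set c = (1-β)·b⁺ + β·b⁻. For each b ∈ ℝ define (x^b_t) by x^b_0 = x₀ and x^b_{t+1} = x^b_t - 2η·(x^b_t - (q + b/(1-γ))). Then for every t ∈ ℕ, (1-β)·(x^{b⁺}_t - b⁺/(1-γ)) + β·(x^{b⁻}_t - b⁻/(1-γ)) = x^{c}_t - c/(1-γ). -/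
theorem shifted_estimate_linear_combination
    (γ : ℝ) (hγ0 : 0 ≤ γ) (hγ1 : γ < 1)
    (η q x₀ β bp bm : ℝ)
    (c : ℝ) (hc : c = (1 - β) * bp + β * bm)
    (x : ℝ → ℕ → ℝ)
    (hx0 : ∀ b : ℝ, x b 0 = x₀)
    (hrec : ∀ (b : ℝ) (t : ℕ),
      x b (t + 1) = x b t - 2 * η * (x b t - (q + b / (1 - γ)))) :
    ∀ t : ℕ,
      (1 - β) * (x bp t - bp / (1 - γ)) + β * (x bm t - bm / (1 - γ)) =
        x c t - c / (1 - γ) := by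
  intro t
  induction t with
  | zero =>
    rw [hx0, hx0, hx0, hc]
    ring
  | succ t ih =>
    rw [hrec, hrec, hrec]
    linear_combination (1 - 2 * η) * ih
end

section
/- Let γ ∈ [0,1), η ∈ ℝ, x₀ ∈ ℝ, and b⁺, b⁻ ∈ ℝ. For each b ∈ ℝ and each target value q ∈ ℝ define (x^b_t(q)) by x^b_0(q) = x₀ and x^b_{t+1}(q) = x^b_t(q) - 2η·(x^b_t(q) - (q + b/(1-γ))). Then for every q ∈ ℝ and every t ∈ ℕ, the exploration bonus (x^{b⁻}_t(q) - b⁻/(1-γ)) - (x^{b⁺}_t(q) - b⁺/(1-γ)) = (1-2η)^t · (b⁺ - b⁻)/(1-γ). In particular this difference does not depend on q or x₀. -/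
theorem exploration_bonus_formula
    (γ : ℝ) (hγ0 : 0 ≤ γ) (hγ1 : γ < 1)
    (η x₀ bp bm : ℝ)
    (x : ℝ → ℝ → ℕ → ℝ)
    (hx0 : ∀ (b q : ℝ), x b q 0 = x₀)
    (hrec : ∀ (b q : ℝ) (t : ℕ),
      x b q (t + 1) = x b q t - 2 * η * (x b q t - (q + b / (1 - γ)))) :
    ∀ (q : ℝ) (t : ℕ),
      (x bm q t - bm / (1 - γ)) - (x bp q t - bp / (1 - γ)) =
        (1 - 2 * η) ^ t * (bp - bm) / (1 - γ) := by
  intro q t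
  induction t with
  | zero =>
    rw [hx0, hx0]
    ring
  | succ t ih =>
    rw [hrec, hrec, pow_succ]
    linear_combination (1 - 2 * η) * ih
end

section
/- Let S and A be types, let Q* : S × A → ℝ, let γ ∈ [0,1), let η ∈ ℝ with 0 ≤ η ≤ 1/2, and let b⁻ ∈ ℝ satisfy Q*(s,a) + b⁻/(1-γ) ≤ 0 for all (s,a). For each (s,a) define the sequence x_t(s,a) by x_0(s,a) = 0 and x_{t+1}(s,a) = x_t(s,a) - 2η·(x_t(s,a) - (Q*(s,a) + b⁻/(1-γ))). Then for every t ∈ ℕ and every (s,a), the optimistic estimate Q̃_{UB,t}(s,a) := x_t(s,a) - b⁻/(1-γ) satisfies Q̃_{UB,t}(s,a) ≥ Q*(s,a). -/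
theorem optimistic_estimate_upper_bound
    (S A : Type*) (Qstar : S × A → ℝ)
    (γ : ℝ) (hγ0 : 0 ≤ γ) (hγ1 : γ < 1)
    (η : ℝ) (hη0 : 0 ≤ η) (hη1 : η ≤ 1 / 2)
    (bm : ℝ) (hbm : ∀ p : S × A, Qstar p + bm / (1 - γ) ≤ 0)
    (x : S × A → ℕ → ℝ)
    (hx0 : ∀ p : S × A, x p 0 = 0)
    (hrec : ∀ (p : S × A) (t : ℕ),
      x p (t + 1) = x p t - 2 * η * (x p t - (Qstar p + bm / (1 - γ)))) :
    ∀ (t : ℕ) (p : S × A), Qstar p ≤ x p t - bm / (1 - γ) := by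
  intro t p
  have h : Qstar p + bm / (1 - γ) ≤ x p t := by
    induction t with
    | zero => simpa only [hx0] using hbm p
    | succ t ih =>
      rw [hrec]
      have hη : 0 ≤ 1 - 2 * η := by linarith
      linarith [mul_nonneg hη (sub_nonneg.mpr ih)]
  linarith
end
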